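/- arXiv:1002.0558 — 2 statements merged into one kernel-verified Lean document; each statement's English description precedes it below -/
import Mathlib

section
/- Let ℓ ≥ 2, let λ be a partition and let ī ∈ ℤ/ℓℤ. Then in the field ℚ(v) of rational functions, Σ_{b ∈ A_ī(λ)} v^{N^l_ī((λ∪b)/λ) − N^r_ī((λ∪b)/λ)} − Σ_{b ∈ R_ī(λ)} v^{N^l_ī(λ/(λ∖b)) − N^r_ī(λ/(λ∖b))} = (v^{N_ī(λ)} − v^{−N_ī(λ)})/(v − v⁻¹), where N_ī(λ) = #A_ī(λ) − #R_ī(λ). -/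
open scoped Classical

namespace MisraMiwa

/-- The content of a box `b = (i, j)` (row `i`, column `j`, indexed from 0): column minus row. -/
def content (b : ℕ × ℕ) : ℤ := (b.2 : ℤ) - (b.1 : ℤ)

/-- The color of a box: its content modulo `ℓ`. -/
def color (ℓ : ℕ) (b : ℕ × ℕ) : ZMod ℓ := (content b : ZMod ℓ)

/-- `b` is an addable box of the partition (Young diagram) `μ`. -/
def IsAddable (μ : YoungDiagram) (b : ℕ × ℕ) : Prop :=
  b ∉ μ ∧ ∃ ν : YoungDiagram, (ν : Set (ℕ × ℕ)) = insert b (μ : Set (ℕ × ℕ))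

/-- `b` is a removable box of the partition (Young diagram) `μ`. -/
def IsRemovable (μ : YoungDiagram) (b : ℕ × ℕ) : Prop :=
  b ∈ μ ∧ ∃ ν : YoungDiagram, (ν : Set (ℕ × ℕ)) = (μ : Set (ℕ × ℕ)) \ {b}

/-- The partition obtained from `μ` by adding the addable box `b`. -/
noncomputable def added (μ : YoungDiagram) (b : ℕ × ℕ) : YoungDiagram :=
  if h : IsAddable μ b then h.2.choose else μ

/-- The partition obtained from `μ` by removing the removable box `b`. -/
noncomputable def erased (μ : YoungDiagram) (b : ℕ × ℕ) : YoungDiagram :=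
  if h : IsRemovable μ b then h.2.choose else μ

/-- `A ℓ i μ` : the set of addable boxes of `μ` of color `i`. -/
def A (ℓ : ℕ) (i : ZMod ℓ) (μ : YoungDiagram) : Set (ℕ × ℕ) :=
  {b | IsAddable μ b ∧ color ℓ b = i}

/-- `R ℓ i μ` : the set of removable boxes of `μ` of color `i`. -/
def R (ℓ : ℕ) (i : ZMod ℓ) (μ : YoungDiagram) : Set (ℕ × ℕ) :=
  {b | IsRemovable μ b ∧ color ℓ b = i}

/-- `Nc ℓ i μ = #A_i(μ) - #R_i(μ)`. -/
noncomputable def Nc (ℓ : ℕ) (i : ZMod ℓ) (μ : YoungDiagram) : ℤ :=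
  ((A ℓ i μ).ncard : ℤ) - ((R ℓ i μ).ncard : ℤ)

/-- `b'` is to the left of `b` : its content is strictly larger. -/
def LeftOf (b' b : ℕ × ℕ) : Prop := content b < content b'

/-- `b'` is to the right of `b` : its content is strictly smaller. -/
def RightOf (b' b : ℕ × ℕ) : Prop := content b' < content b

/-- `Nl ℓ i μ b` : number of removable boxes of `μ` of color `i` to the left of `b`
minus number of addable boxes of `μ` of color `i` to the left of `b`. -/
noncomputable def Nl (ℓ : ℕ) (i : ZMod ℓ) (μ : YoungDiagram) (b : ℕ × ℕ) : ℤ :=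
  ({b' | b' ∈ R ℓ i μ ∧ LeftOf b' b}.ncard : ℤ) - ({b' | b' ∈ A ℓ i μ ∧ LeftOf b' b}.ncard : ℤ)

/-- `Nr ℓ i μ b` : as `Nl`, but to the right of `b`. -/
noncomputable def Nr (ℓ : ℕ) (i : ZMod ℓ) (μ : YoungDiagram) (b : ℕ × ℕ) : ℤ :=
  ({b' | b' ∈ R ℓ i μ ∧ RightOf b' b}.ncard : ℤ) - ({b' | b' ∈ A ℓ i μ ∧ RightOf b' b}.ncard : ℤ)

/-- The `v`-deformed Fock space: the `ℚ(v)`-vector space with basis indexed by partitions. -/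
abbrev Fock : Type := YoungDiagram →₀ RatFunc ℚ

/-- The indeterminate `v` of `ℚ(v)`. -/
noncomputable def v : RatFunc ℚ := RatFunc.X

/-- `E_i |λ⟩ = Σ_μ v^(-N^r_i(λ/μ)) |μ⟩`, sum over `μ ⊂ λ` with `λ/μ` one box of color `i`. -/
noncomputable def Evec (ℓ : ℕ) (i : ZMod ℓ) (lam : YoungDiagram) : Fock :=
  ∑ᶠ b ∈ R ℓ i lam,
    v ^ (-Nr ℓ i (erased lam b) b) • Finsupp.single (erased lam b) (1 : RatFunc ℚ)

/-- `F_i |λ⟩ = Σ_μ v^(N^l_i(μ/λ)) |μ⟩`, sum over `μ ⊃ λ` with `μ/λ` one box of color `i`. -/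
noncomputable def Fvec (ℓ : ℕ) (i : ZMod ℓ) (lam : YoungDiagram) : Fock :=
  ∑ᶠ b ∈ A ℓ i lam,
    v ^ (Nl ℓ i lam b) • Finsupp.single (added lam b) (1 : RatFunc ℚ)

/-- The Misra–Miwa operator `E_i`. -/
noncomputable def Eop (ℓ : ℕ) (i : ZMod ℓ) : Fock →ₗ[RatFunc ℚ] Fock :=
  Finsupp.lsum (RatFunc ℚ) fun lam => LinearMap.toSpanSingleton (RatFunc ℚ) Fock (Evec ℓ i lam)

/-- The Misra–Miwa operator `F_i`. -/
noncomputable def Fop (ℓ : ℕ) (i : ZMod ℓ) : Fock →ₗ[RatFunc ℚ] Fock :=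
  Finsupp.lsum (RatFunc ℚ) fun lam => LinearMap.toSpanSingleton (RatFunc ℚ) Fock (Fvec ℓ i lam)

/-- The Misra–Miwa operator `K_i` : `K_i |λ⟩ = v^(N_i(λ)) |λ⟩`. -/
noncomputable def Kop (ℓ : ℕ) (i : ZMod ℓ) : Fock →ₗ[RatFunc ℚ] Fock :=
  Finsupp.lsum (RatFunc ℚ) fun lam =>
    LinearMap.toSpanSingleton (RatFunc ℚ) Fock (v ^ Nc ℓ i lam • Finsupp.single lam (1 : RatFunc ℚ))

/-- The inverse operator `K_i⁻¹ |λ⟩ = v^(-N_i(λ)) |λ⟩`. -/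
noncomputable def Kinvop (ℓ : ℕ) (i : ZMod ℓ) : Fock →ₗ[RatFunc ℚ] Fock :=
  Finsupp.lsum (RatFunc ℚ) fun lam =>
    LinearMap.toSpanSingleton (RatFunc ℚ) Fock
      (v ^ (-Nc ℓ i lam) • Finsupp.single lam (1 : RatFunc ℚ))

/-- The Cartan matrix entry of affine type `A^{(1)}_{ℓ-1}`. -/
noncomputable def cartan (ℓ : ℕ) (i j : ZMod ℓ) : ℤ :=
  2 * (if i = j then 1 else 0)
    - (({1, -1} : Finset ℤ).filter (fun e => j = i + (e : ZMod ℓ))).card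

/-- The `q`-integer `[n] = (q^n - q^{-n})/(q - q⁻¹)` in `ℚ(q)` (here `q = v`). -/
noncomputable def qint (n : ℤ) : RatFunc ℚ := (v ^ n - v ^ (-n)) / (v - v⁻¹)

/-- `hasVal p x n` : the nonzero rational function `x` has `p`-adic valuation `n`. -/
def hasVal (p : Polynomial ℚ) (x : RatFunc ℚ) (n : ℤ) : Prop :=
  ∃ a b : Polynomial ℚ, ¬ p ∣ a ∧ ¬ p ∣ b ∧
    x = algebraMap (Polynomial ℚ) (RatFunc ℚ) p ^ n *
        (algebraMap (Polynomial ℚ) (RatFunc ℚ) a / algebraMap (Polynomial ℚ) (RatFunc ℚ) b)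

/-- Addable boxes of `μ` in rows strictly above row `k` (rows indexed from 0). -/
def Alt (μ : YoungDiagram) (k : ℕ) : Set (ℕ × ℕ) := {b | IsAddable μ b ∧ b.1 < k}

/-- Removable boxes of `μ` in rows strictly above row `k` (rows indexed from 0). -/
def Rlt (μ : YoungDiagram) (k : ℕ) : Set (ℕ × ℕ) := {b | IsRemovable μ b ∧ b.1 < k}

/-- The degree-`n` component of Fock space: the span of `|λ⟩` for `|λ| = n`. -/
noncomputable def degComp (n : ℕ) : Submodule (RatFunc ℚ) Fock :=
  Submodule.span (RatFunc ℚ)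
    {f | ∃ lam : YoungDiagram, lam.card = n ∧ f = Finsupp.single lam (1 : RatFunc ℚ)}


theorem isAddable_iff (μ : YoungDiagram) (b : ℕ × ℕ) :
    IsAddable μ b ↔ b ∉ μ ∧ ∀ y, y < b → y ∈ μ := by
  constructor
  · rintro ⟨h, ν, hν⟩
    refine ⟨h, fun y hy => ?_⟩
    have hm : ∀ x, x ∈ ν ↔ x = b ∨ x ∈ μ := fun x => by
      have := Set.ext_iff.1 hν x
      simpa using this
    have h1 : y ∈ ν := ν.isLowerSet hy.le ((hm b).2 (Or.inl rfl))
    exact ((hm y).1 h1).resolve_left hy.ne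
  · rintro ⟨h, h2⟩
    refine ⟨h, ⟨insert b μ.cells, ?_⟩, Finset.coe_insert b μ.cells⟩
    intro x y hyx hx
    simp only [Finset.coe_insert, Set.mem_insert_iff, Finset.mem_coe, YoungDiagram.mem_cells] at hx ⊢
    rcases hx with rfl | hx
    · rcases hyx.eq_or_lt with h3 | h3
      · exact Or.inl h3
      · exact Or.inr (h2 y h3)
    · exact Or.inr (μ.isLowerSet hyx hx)

theorem isRemovable_iff (μ : YoungDiagram) (b : ℕ × ℕ) :
    IsRemovable μ b ↔ b ∈ μ ∧ ∀ y, b < y → y ∉ μ := by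
  constructor
  · rintro ⟨h, ν, hν⟩
    refine ⟨h, fun y hy hyμ => ?_⟩
    have hm : ∀ x, x ∈ ν ↔ x ∈ μ ∧ x ≠ b := fun x => by
      have := Set.ext_iff.1 hν x
      simpa using this
    have h1 : b ∈ ν := ν.isLowerSet hy.le ((hm y).2 ⟨hyμ, hy.ne'⟩)
    exact ((hm b).1 h1).2 rfl
  · rintro ⟨h, h2⟩
    refine ⟨h, ⟨μ.cells.erase b, ?_⟩, Finset.coe_erase b μ.cells⟩
    intro x y hyx hx
    simp only [Finset.coe_erase, Set.mem_sdiff, Finset.mem_coe, YoungDiagram.mem_cells,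
      Set.mem_singleton_iff] at hx ⊢
    refine ⟨μ.isLowerSet hyx hx.1, ?_⟩
    rintro rfl
    exact h2 x (lt_of_le_of_ne hyx (Ne.symm hx.2)) hx.1

theorem mem_erased {μ : YoungDiagram} {b : ℕ × ℕ} (h : IsRemovable μ b) (x : ℕ × ℕ) :
    x ∈ erased μ b ↔ x ∈ μ ∧ x ≠ b := by
  have := Set.ext_iff.1 h.2.choose_spec x
  rw [erased, dif_pos h]
  simpa using this

theorem exists_between {a b : ℕ × ℕ} (h : a < b) (h1 : content b ≠ content a + 1)
    (h2 : content b ≠ content a - 1) : ∃ y, a < y ∧ y < b := by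
  obtain ⟨r, c⟩ := a
  obtain ⟨s, d⟩ := b
  simp only [content] at h1 h2
  simp only [Prod.mk_lt_mk] at h
  by_cases hr : r < s
  · refine ⟨(r + 1, c), ?_, ?_⟩ <;> simp only [Prod.mk_lt_mk] <;> omega
  · refine ⟨(r, c + 1), ?_, ?_⟩ <;> simp only [Prod.mk_lt_mk] <;> omega

theorem addable_erased {μ : YoungDiagram} {b x : ℕ × ℕ} (h : IsRemovable μ b)
    (h0 : content x ≠ content b) (h1 : content x ≠ content b + 1)
    (h2 : content x ≠ content b - 1) :
    IsAddable (erased μ b) x ↔ IsAddable μ x := by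
  have hxb : x ≠ b := by rintro rfl; exact h0 rfl
  have hr := (isRemovable_iff μ b).1 h
  rw [isAddable_iff, isAddable_iff]
  simp only [mem_erased h]
  constructor
  · rintro ⟨h3, h4⟩
    exact ⟨fun h5 => h3 ⟨h5, hxb⟩, fun y hy => (h4 y hy).1⟩
  · rintro ⟨h3, h4⟩
    refine ⟨fun h5 => h3 h5.1, fun y hy => ⟨h4 y hy, ?_⟩⟩
    rintro rfl
    obtain ⟨z, hz1, hz2⟩ := exists_between hy h1 h2
    exact hr.2 z hz1 (h4 z hz2)

theorem removable_erased {μ : YoungDiagram} {b x : ℕ × ℕ} (h : IsRemovable μ b)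
    (h0 : content x ≠ content b) (h1 : content x ≠ content b + 1)
    (h2 : content x ≠ content b - 1) :
    IsRemovable (erased μ b) x ↔ IsRemovable μ x := by
  have hxb : x ≠ b := by rintro rfl; exact h0 rfl
  have hr := (isRemovable_iff μ b).1 h
  rw [isRemovable_iff, isRemovable_iff]
  simp only [mem_erased h]
  constructor
  · rintro ⟨h3, h4⟩
    refine ⟨h3.1, fun y hy hyμ => ?_⟩
    by_cases hyb : y = b
    · subst hyb
      obtain ⟨z, hz1, hz2⟩ := exists_between hy (by omega) (by omega)
      exact h4 z hz1 ⟨μ.isLowerSet hz2.le hr.1, hz2.ne⟩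
    · exact h4 y hy ⟨hyμ, hyb⟩
  · rintro ⟨h3, h4⟩
    exact ⟨⟨h3, hxb⟩, fun y hy h5 => h4 y hy h5.1⟩

theorem color_ne {ℓ : ℕ} (hℓ : 2 ≤ ℓ) {x b : ℕ × ℕ} (h : color ℓ x = color ℓ b) :
    content x ≠ content b + 1 ∧ content x ≠ content b - 1 := by
  have : Fact (1 < ℓ) := ⟨hℓ⟩
  unfold color at h
  constructor
  · intro h1
    rw [h1] at h
    push_cast at h
    simp at h
  · intro h1
    rw [h1] at h
    push_cast at h
    simp at h

theorem mem_A_erased {ℓ : ℕ} (hℓ : 2 ≤ ℓ) {i : ZMod ℓ} {μ : YoungDiagram} {b x : ℕ × ℕ}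
    (h : b ∈ R ℓ i μ) (h0 : content x ≠ content b) :
    x ∈ A ℓ i (erased μ b) ↔ x ∈ A ℓ i μ := by
  simp only [A, Set.mem_ofPred_eq]
  refine and_congr_left fun hc => ?_
  obtain ⟨h1, h2⟩ := color_ne hℓ (hc.trans h.2.symm)
  exact addable_erased h.1 h0 h1 h2

theorem mem_R_erased {ℓ : ℕ} (hℓ : 2 ≤ ℓ) {i : ZMod ℓ} {μ : YoungDiagram} {b x : ℕ × ℕ}
    (h : b ∈ R ℓ i μ) (h0 : content x ≠ content b) :
    x ∈ R ℓ i (erased μ b) ↔ x ∈ R ℓ i μ := by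
  simp only [R, Set.mem_ofPred_eq]
  refine and_congr_left fun hc => ?_
  obtain ⟨h1, h2⟩ := color_ne hℓ (hc.trans h.2.symm)
  exact removable_erased h.1 h0 h1 h2

theorem Nl_erased {ℓ : ℕ} (hℓ : 2 ≤ ℓ) {i : ZMod ℓ} {μ : YoungDiagram} {b : ℕ × ℕ}
    (h : b ∈ R ℓ i μ) : Nl ℓ i (erased μ b) b = Nl ℓ i μ b := by
  unfold Nl
  congr 3
  · ext x
    simp only [Set.mem_ofPred_eq]
    exact and_congr_left fun hl => mem_R_erased hℓ h (ne_of_gt hl)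
  · ext x
    simp only [Set.mem_ofPred_eq]
    exact and_congr_left fun hl => mem_A_erased hℓ h (ne_of_gt hl)

theorem Nr_erased {ℓ : ℕ} (hℓ : 2 ≤ ℓ) {i : ZMod ℓ} {μ : YoungDiagram} {b : ℕ × ℕ}
    (h : b ∈ R ℓ i μ) : Nr ℓ i (erased μ b) b = Nr ℓ i μ b := by
  unfold Nr
  congr 3
  · ext x
    simp only [Set.mem_ofPred_eq]
    exact and_congr_left fun hl => mem_R_erased hℓ h (ne_of_lt hl)
  · ext x
    simp only [Set.mem_ofPred_eq]
    exact and_congr_left fun hl => mem_A_erased hℓ h (ne_of_lt hl)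

theorem finite_R (ℓ : ℕ) (i : ZMod ℓ) (μ : YoungDiagram) : (R ℓ i μ).Finite :=
  μ.cells.finite_toSet.subset fun x hx => by simpa using hx.1.1

theorem finite_A (ℓ : ℕ) (i : ZMod ℓ) (μ : YoungDiagram) : (A ℓ i μ).Finite := by
  refine (insert (0, 0) (μ.cells.image (fun x => (x.1 + 1, x.2)) ∪
    μ.cells.image (fun x => (x.1, x.2 + 1)))).finite_toSet.subset ?_
  rintro ⟨r, c⟩ hx
  have h := ((isAddable_iff _ _).1 hx.1).2
  simp only [Finset.coe_insert, Finset.coe_union, Finset.coe_image, Set.mem_insert_iff,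
    Set.mem_union, Set.mem_image, Finset.mem_coe, YoungDiagram.mem_cells]
  rcases r with _ | r
  · rcases c with _ | c
    · exact Or.inl rfl
    · exact Or.inr (Or.inr ⟨(0, c), h _ (by simp [Prod.mk_lt_mk]), rfl⟩)
  · exact Or.inr (Or.inl ⟨(r, c), h _ (by simp [Prod.mk_lt_mk]), rfl⟩)

/-- Two boxes of the same content are comparable. -/
theorem content_trichotomy {a b : ℕ × ℕ} (h : content a = content b) :
    a = b ∨ (a < b ∧ ∃ y, a < y ∧ y < b) ∨ (b < a ∧ ∃ y, b < y ∧ y < a) := by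
  have key : a = b ∨ a < b ∨ b < a := by
    obtain ⟨r, c⟩ := a
    obtain ⟨s, d⟩ := b
    simp only [content] at h
    simp only [Prod.mk_lt_mk, Prod.mk.injEq]
    omega
  rcases key with h1 | h1 | h1
  · exact Or.inl h1
  · exact Or.inr (Or.inl ⟨h1, exists_between h1 (by omega) (by omega)⟩)
  · exact Or.inr (Or.inr ⟨h1, exists_between h1 (by omega) (by omega)⟩)

theorem content_inj {μ : YoungDiagram} {a b : ℕ × ℕ} (ha : IsAddable μ a ∨ IsRemovable μ a)
    (hb : IsAddable μ b ∨ IsRemovable μ b) (h : content a = content b) : a = b := by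
  have aux : ∀ {a b : ℕ × ℕ}, (IsAddable μ a ∨ IsRemovable μ a) →
      (IsAddable μ b ∨ IsRemovable μ b) → a < b → (∃ y, a < y ∧ y < b) → False := by
    rintro a b ha hb hab ⟨y, hy1, hy2⟩
    simp only [isAddable_iff, isRemovable_iff] at ha hb
    rcases ha with ⟨ha1, ha2⟩ | ⟨ha1, ha2⟩ <;> rcases hb with ⟨hb1, hb2⟩ | ⟨hb1, hb2⟩
    · exact ha1 (hb2 a hab)
    · exact ha1 (μ.isLowerSet hab.le hb1)
    · exact ha2 y hy1 (hb2 y hy2)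
    · exact ha2 b hab hb1
  rcases content_trichotomy h with h1 | ⟨h1, h2⟩ | ⟨h1, h2⟩
  · exact h1
  · exact (aux ha hb h1 h2).elim
  · exact (aux hb ha h1 h2).elim

theorem telescope {K α : Type*} [Field K] (x : K) (hx : x ≠ 0) (c : α → ℤ) (ε : α → ℤ)
    (S : Finset α) : Set.InjOn c S →
    ∑ b ∈ S, (x ^ ε b - x ^ (-ε b)) *
      x ^ (∑ b' ∈ S with c b' < c b, ε b' - ∑ b' ∈ S with c b < c b', ε b')
    = x ^ (∑ b ∈ S, ε b) - x ^ (-∑ b ∈ S, ε b) := by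
  induction S using Finset.induction_on_max_value c with
  | empty => simp
  | insert a s ha hmax ih =>
    intro hinj
    have ih := ih (hinj.mono (by simp))
    have hlt : ∀ y ∈ s, c y < c a := fun y hy =>
      lt_of_le_of_ne (hmax y hy) fun h =>
        ha (by rw [← hinj (by simp [hy]) (by simp) h]; exact hy)
    rw [Finset.sum_insert ha, Finset.sum_insert ha]
    have e1 : (insert a s).filter (fun b' => c b' < c a) = s := by
      ext y
      simp only [Finset.mem_filter, Finset.mem_insert]
      constructor
      · rintro ⟨rfl | h, h2⟩
        · exact (lt_irrefl _ h2).elim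
        · exact h
      · exact fun h => ⟨Or.inr h, hlt y h⟩
    have e2 : (insert a s).filter (fun b' => c a < c b') = ∅ := by
      ext y
      simp only [Finset.mem_filter, Finset.mem_insert, Finset.notMem_empty, iff_false]
      rintro ⟨rfl | h, h2⟩
      · exact lt_irrefl _ h2
      · exact lt_asymm h2 (hlt y h)
    have e3 : ∀ b ∈ s, (x ^ ε b - x ^ (-ε b)) *
        x ^ (∑ b' ∈ insert a s with c b' < c b, ε b' - ∑ b' ∈ insert a s with c b < c b', ε b')
        = x ^ (-ε a) * ((x ^ ε b - x ^ (-ε b)) *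
        x ^ (∑ b' ∈ s with c b' < c b, ε b' - ∑ b' ∈ s with c b < c b', ε b')) := by
      intro b hb
      rw [Finset.filter_insert, if_neg (lt_asymm (hlt b hb)), Finset.filter_insert,
        if_pos (hlt b hb), Finset.sum_insert (by simp [ha]), mul_left_comm, ← zpow_add₀ hx]
      congr 2
      ring
    rw [Finset.sum_congr rfl e3, ← Finset.mul_sum, ih, e1, e2]
    simp only [Finset.sum_empty, sub_zero, sub_mul, mul_sub, ← zpow_add₀ hx]
    rw [neg_add, add_comm (-ε a) (∑ b ∈ s, ε b)]
    ring

theorem stmt8_aux (ℓ : ℕ) (i : ZMod ℓ) (lam : YoungDiagram) (P : ℕ × ℕ → Prop)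
    [DecidablePred P] :
    ∑ b ∈ ((finite_A ℓ i lam).toFinset ∪ (finite_R ℓ i lam).toFinset) with P b,
      (if b ∈ A ℓ i lam then (1 : ℤ) else -1)
    = ({b | b ∈ A ℓ i lam ∧ P b}.ncard : ℤ) - ({b | b ∈ R ℓ i lam ∧ P b}.ncard : ℤ) := by
  have hd : ∀ b, b ∈ R ℓ i lam → b ∉ A ℓ i lam := fun b hb hb' => hb'.1.1 hb.1.1
  rw [Finset.filter_union, Finset.sum_union]
  · have e1 : {b | b ∈ A ℓ i lam ∧ P b} = ↑((finite_A ℓ i lam).toFinset.filter P) := by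
      ext; simp
    have e2 : {b | b ∈ R ℓ i lam ∧ P b} = ↑((finite_R ℓ i lam).toFinset.filter P) := by
      ext; simp
    rw [e1, e2, Set.ncard_coe_finset, Set.ncard_coe_finset, Finset.sum_congr rfl
      (g := fun _ => (1 : ℤ)), Finset.sum_congr (s₁ := (finite_R ℓ i lam).toFinset.filter P) rfl
      (g := fun _ => (-1 : ℤ))]
    · simp [sub_eq_add_neg]
    · intro b hb
      simp only [Finset.mem_filter, Set.Finite.mem_toFinset] at hb
      exact if_neg (hd b hb.1)
    · intro b hb
      simp only [Finset.mem_filter, Set.Finite.mem_toFinset] at hb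
      exact if_pos hb.1
  · rw [Finset.disjoint_left]
    intro b hb hb'
    simp only [Finset.mem_filter, Set.Finite.mem_toFinset] at hb hb'
    exact hd b hb'.1 hb.1

theorem v_sub_ne : v - v⁻¹ ≠ 0 := by
  have hv : v ≠ 0 := RatFunc.X_ne_zero
  intro h
  have h1 : v * v = 1 := by
    have := sub_eq_zero.1 h
    nth_rewrite 2 [this]
    exact mul_inv_cancel₀ hv
  have h2 : (Polynomial.X * Polynomial.X : Polynomial ℚ) = 1 := by
    apply RatFunc.algebraMap_injective ℚ
    simpa [v] using h1
  have h3 := congrArg (Polynomial.eval 0) h2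
  simp at h3

theorem stmt8 (ℓ : ℕ) (hℓ : 2 ≤ ℓ) (lam : YoungDiagram) (i : ZMod ℓ) :
    (∑ᶠ b ∈ A ℓ i lam, v ^ (Nl ℓ i lam b - Nr ℓ i lam b))
      - (∑ᶠ b ∈ R ℓ i lam, v ^ (Nl ℓ i (erased lam b) b - Nr ℓ i (erased lam b) b))
      = (v ^ Nc ℓ i lam - v ^ (-Nc ℓ i lam)) / (v - v⁻¹) := by
  have hv : v ≠ 0 := RatFunc.X_ne_zero
  have hd : ∀ b, b ∈ R ℓ i lam → b ∉ A ℓ i lam := fun b hb hb' => hb'.1.1 hb.1.1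
  rw [eq_div_iff v_sub_ne]
  have hR : (∑ᶠ b ∈ R ℓ i lam, v ^ (Nl ℓ i (erased lam b) b - Nr ℓ i (erased lam b) b))
      = ∑ᶠ b ∈ R ℓ i lam, v ^ (Nl ℓ i lam b - Nr ℓ i lam b) :=
    finsum_mem_congr rfl fun b hb => by rw [Nl_erased hℓ hb, Nr_erased hℓ hb]
  rw [hR, finsum_mem_eq_finite_toFinset_sum _ (finite_A ℓ i lam),
    finsum_mem_eq_finite_toFinset_sum _ (finite_R ℓ i lam)]
  have T := telescope v hv content (fun b => if b ∈ A ℓ i lam then (1 : ℤ) else -1)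
    ((finite_A ℓ i lam).toFinset ∪ (finite_R ℓ i lam).toFinset) (by
      intro a ha b hb h
      simp only [Finset.coe_union, Set.Finite.coe_toFinset, Set.mem_union] at ha hb
      exact content_inj (ha.imp And.left And.left) (hb.imp And.left And.left) h)
  have hN : ∑ b ∈ ((finite_A ℓ i lam).toFinset ∪ (finite_R ℓ i lam).toFinset),
      (if b ∈ A ℓ i lam then (1 : ℤ) else -1) = Nc ℓ i lam := by
    have := stmt8_aux ℓ i lam (fun _ => True)
    simpa [Nc] using this
  have hE : ∀ b, ∑ b' ∈ ((finite_A ℓ i lam).toFinset ∪ (finite_R ℓ i lam).toFinset)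
        with content b' < content b, (if b' ∈ A ℓ i lam then (1 : ℤ) else -1)
      - ∑ b' ∈ ((finite_A ℓ i lam).toFinset ∪ (finite_R ℓ i lam).toFinset)
        with content b < content b', (if b' ∈ A ℓ i lam then (1 : ℤ) else -1)
      = Nl ℓ i lam b - Nr ℓ i lam b := by
    intro b
    have h1 := stmt8_aux ℓ i lam (fun b' => content b' < content b)
    have h2 := stmt8_aux ℓ i lam (fun b' => content b < content b')
    unfold Nl Nr LeftOf RightOf
    rw [h1, h2]
    ring
  simp only [hE] at T
  rw [hN] at T
  rw [← T, Finset.sum_union, sub_mul, Finset.sum_mul, Finset.sum_mul, sub_eq_add_neg,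
    ← Finset.sum_neg_distrib]
  · congr 1
    · refine Finset.sum_congr rfl fun b hb => ?_
      rw [if_pos ((Set.Finite.mem_toFinset _).1 hb), zpow_one, zpow_neg_one, mul_comm]
    · refine Finset.sum_congr rfl fun b hb => ?_
      rw [if_neg (hd b ((Set.Finite.mem_toFinset _).1 hb)), neg_neg, zpow_one, zpow_neg_one]
      ring
  · rw [Finset.disjoint_left]
    intro b hb hb'
    exact hd b ((Set.Finite.mem_toFinset _).1 hb') ((Set.Finite.mem_toFinset _).1 hb)

end MisraMiwa
end

section
/- Let ℓ ≥ 2, let λ be a partition, let k ≥ 1, and suppose the box b = (k, λ_k + 1) is addable for λ (i.e., k = 1 or λ_{k−1} > λ_k). Set c = c(b) = λ_k + 1 − k, let ī ∈ ℤ/ℓℤ be the residue of c modulo ℓ, and let μ = λ ∪ {b}. Then the element ( ∏_{r ∈ R(λ,<k)} [c(r) − c] ) / ( ∏_{a ∈ A(λ,<k)} [c(a) − c] ) of ℚ(q) is nonzero and its Φ_{2ℓ}-adic valuation equals N^l_ī(μ/λ), i.e., the multiplicity of the 2ℓ-th cyclotomic polynomial Φ_{2ℓ}(q) in the numerator minus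 its multiplicity in the denominator equals #{removable boxes of λ of color ī to the left of b} − #{addable boxes of λ of color ī to the left of b}. -/
open scoped Classical

namespace MisraMiwa

open Polynomial in
theorem cyc_dvd_iff (ℓ : ℕ) (hℓ : 2 ≤ ℓ) : ∃ ζ : ℂ, IsPrimitiveRoot ζ (2 * ℓ) ∧
    ∀ p : ℚ[X], cyclotomic (2 * ℓ) ℚ ∣ p ↔ aeval ζ p = 0 := by
  have h0 : 2 * ℓ ≠ 0 := by omega
  refine ⟨_, Complex.isPrimitiveRoot_exp (2 * ℓ) h0, fun p => ?_⟩
  rw [cyclotomic_eq_minpoly_rat (Complex.isPrimitiveRoot_exp (2 * ℓ) h0) (by omega),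
    minpoly.dvd_iff]

open Polynomial in
theorem cyc_prime (ℓ : ℕ) (hℓ : 2 ≤ ℓ) : Prime (cyclotomic (2 * ℓ) ℚ) :=
  (cyclotomic.irreducible_rat (by omega)).prime

open Polynomial in
theorem cyc_dvd_pow_sub (ℓ : ℕ) (hℓ : 2 ≤ ℓ) (n : ℕ) :
    cyclotomic (2 * ℓ) ℚ ∣ X ^ (2 * n) - 1 ↔ ℓ ∣ n := by
  obtain ⟨ζ, hz, h⟩ := cyc_dvd_iff ℓ hℓ
  rw [h]
  simp only [map_sub, map_pow, aeval_X, map_one, sub_eq_zero, hz.pow_eq_one_iff_dvd]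
  exact Nat.mul_dvd_mul_iff_left (by norm_num)

open Polynomial in
theorem cyc_not_dvd_X (ℓ : ℕ) (hℓ : 2 ≤ ℓ) : ¬ cyclotomic (2 * ℓ) ℚ ∣ X := by
  obtain ⟨ζ, hz, h⟩ := cyc_dvd_iff ℓ hℓ
  rw [h]
  simpa using hz.ne_zero (by omega)

theorem hasVal_mul {p : Polynomial ℚ} (hp : Prime p) {x y : RatFunc ℚ} {m n : ℤ}
    (hx : hasVal p x m) (hy : hasVal p y n) : hasVal p (x * y) (m + n) := by
  obtain ⟨a, b, ha, hb, rfl⟩ := hx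
  obtain ⟨c, d, hc, hd, rfl⟩ := hy
  refine ⟨a * c, b * d, ?_, ?_, ?_⟩
  · intro h; rcases hp.dvd_or_dvd h with h | h <;> contradiction
  · intro h; rcases hp.dvd_or_dvd h with h | h <;> contradiction
  · have : algebraMap (Polynomial ℚ) (RatFunc ℚ) p ≠ 0 := by
      simpa using hp.ne_zero
    rw [zpow_add₀ this, map_mul, map_mul, mul_mul_mul_comm, div_mul_div_comm]

theorem hasVal_inv {p : Polynomial ℚ} {x : RatFunc ℚ} {m : ℤ}
    (hx : hasVal p x m) : hasVal p x⁻¹ (-m) := by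
  obtain ⟨a, b, ha, hb, rfl⟩ := hx
  exact ⟨b, a, hb, ha, by rw [mul_inv, inv_div, zpow_neg]⟩

theorem hasVal_one {p : Polynomial ℚ} (hp : Prime p) : hasVal p 1 0 :=
  ⟨1, 1, hp.not_dvd_one, hp.not_dvd_one, by simp⟩

theorem hasVal_ne_zero {p : Polynomial ℚ} (hp : Prime p) {x : RatFunc ℚ} {m : ℤ}
    (hx : hasVal p x m) : x ≠ 0 := by
  obtain ⟨a, b, ha, hb, rfl⟩ := hx
  have h1 : algebraMap (Polynomial ℚ) (RatFunc ℚ) p ≠ 0 := by simpa using hp.ne_zero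
  have h2 : algebraMap (Polynomial ℚ) (RatFunc ℚ) a ≠ 0 := by
    simp; rintro rfl; simp at ha
  have h3 : algebraMap (Polynomial ℚ) (RatFunc ℚ) b ≠ 0 := by
    simp; rintro rfl; simp at hb
  exact mul_ne_zero (zpow_ne_zero _ h1) (div_ne_zero h2 h3)

theorem hasVal_prod {p : Polynomial ℚ} (hp : Prime p) {ι : Type*} (s : Finset ι)
    (f : ι → RatFunc ℚ) (g : ι → ℤ) (h : ∀ x ∈ s, hasVal p (f x) (g x)) :
    hasVal p (∏ x ∈ s, f x) (∑ x ∈ s, g x) := by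
  induction s using Finset.induction_on with
  | empty => simpa using hasVal_one hp
  | insert a s ha ih =>
    rw [Finset.prod_insert ha, Finset.sum_insert ha]
    exact hasVal_mul hp (h _ (Finset.mem_insert_self _ _))
      (ih fun x hx => h x (Finset.mem_insert_of_mem hx))

open Polynomial in
theorem qint_eq (n : ℕ) : qint n = algebraMap ℚ[X] (RatFunc ℚ) ((X ^ (2 * n) - 1) * X) /
    algebraMap ℚ[X] (RatFunc ℚ) (X ^ n * (X ^ 2 - 1)) := by
  have hv : v ≠ 0 := RatFunc.X_ne_zero
  have h2 : v ^ 2 - 1 ≠ 0 := by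
    have : v ^ 2 - 1 = algebraMap ℚ[X] (RatFunc ℚ) (X ^ 2 - 1) := by
      simp [v]
    rw [this]
    have h := X_pow_sub_C_ne_zero (R := ℚ) (n := 2) (by norm_num) 1
    rw [map_one] at h
    exact RatFunc.algebraMap_ne_zero h
  have h3 : v - v⁻¹ = (v ^ 2 - 1) / v := by field_simp
  have h4 : v ^ (n : ℤ) - v ^ (-(n : ℤ)) = (v ^ (2 * n) - 1) / v ^ n := by
    rw [zpow_neg, zpow_natCast]; field_simp; ring
  rw [qint, h3, h4]
  simp only [map_mul, map_sub, map_pow, map_one, RatFunc.algebraMap_X]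
  change _ = (v ^ (2 * n) - 1) * v / (v ^ n * (v ^ 2 - 1))
  rw [div_div_div_eq]

open Polynomial in
theorem hasVal_qint (ℓ : ℕ) (hℓ : 2 ≤ ℓ) (n : ℕ) (hn : 0 < n) :
    hasVal (cyclotomic (2 * ℓ) ℚ) (qint n) (if ℓ ∣ n then 1 else 0) := by
  have hp := cyc_prime ℓ hℓ
  have hX := cyc_not_dvd_X ℓ hℓ
  have h2 : ¬ cyclotomic (2 * ℓ) ℚ ∣ X ^ 2 - 1 := by
    have := cyc_dvd_pow_sub ℓ hℓ 1
    rw [mul_one] at this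
    rw [this, Nat.dvd_one]; omega
  have hden : ¬ cyclotomic (2 * ℓ) ℚ ∣ X ^ n * (X ^ 2 - 1) := by
    intro h
    rcases hp.dvd_or_dvd h with h | h
    · exact hX (hp.dvd_of_dvd_pow h)
    · exact h2 h
  rw [qint_eq]
  split_ifs with h
  · obtain ⟨g, hg⟩ := (cyc_dvd_pow_sub ℓ hℓ n).2 h
    have hsep : (X ^ (2 * n) - 1 : ℚ[X]).Separable := by
      have := separable_X_pow_sub_C (F := ℚ) (n := 2 * n) 1 (by simp; omega) one_ne_zero
      simpa using this
    refine ⟨g * X, _, ?_, hden, ?_⟩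
    · intro h'
      rcases hp.dvd_or_dvd h' with h' | h'
      · obtain ⟨g', rfl⟩ := h'
        apply hp.not_isUnit
        apply hsep.squarefree
        exact ⟨g', by rw [hg, mul_assoc]⟩
      · exact hX h'
    · rw [hg, mul_assoc, map_mul, zpow_one, mul_div_assoc]
  · refine ⟨_, _, ?_, hden, by rw [zpow_zero, one_mul]⟩
    intro h'
    rcases hp.dvd_or_dvd h' with h' | h'
    · exact h ((cyc_dvd_pow_sub ℓ hℓ n).1 h')
    · exact hX h'

theorem addable_rowLen {lam : YoungDiagram} {b : ℕ × ℕ} (h : IsAddable lam b) :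
    lam.rowLen b.1 = b.2 := by
  obtain ⟨i, j⟩ := b
  obtain ⟨h1, ν, hν⟩ := h
  have mem : ∀ x, x ∈ ν ↔ x = (i, j) ∨ x ∈ lam := fun x => by
    have := Set.ext_iff.1 hν x
    simpa using this
  rw [YoungDiagram.mem_iff_lt_rowLen] at h1
  rcases Nat.eq_zero_or_pos j with rfl | hj
  · simp at h1 ⊢; exact h1
  · have h2 : (i, j - 1) ∈ ν :=
      ν.up_left_mem le_rfl (Nat.sub_le _ _) ((mem (i, j)).2 (Or.inl rfl))
    rcases (mem _).1 h2 with h3 | h3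
    · simp at h3; omega
    · rw [YoungDiagram.mem_iff_lt_rowLen] at h3
      simp only; omega

theorem removable_rowLen {lam : YoungDiagram} {b : ℕ × ℕ} (h : IsRemovable lam b) :
    lam.rowLen b.1 = b.2 + 1 ∧ lam.rowLen (b.1 + 1) ≤ b.2 := by
  obtain ⟨i, j⟩ := b
  obtain ⟨h1, ν, hν⟩ := h
  have mem : ∀ x, x ∈ ν ↔ x ∈ lam ∧ x ≠ (i, j) := fun x => by
    have := Set.ext_iff.1 hν x
    simpa using this
  rw [YoungDiagram.mem_iff_lt_rowLen] at h1
  have hn : (i, j) ∉ ν := fun h => ((mem _).1 h).2 rfl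
  have h2 : (i, j + 1) ∉ lam := fun h =>
    hn (ν.up_left_mem le_rfl (Nat.le_succ _) ((mem (i, j + 1)).2 ⟨h, by simp⟩))
  have h3 : (i + 1, j) ∉ lam := fun h =>
    hn (ν.up_left_mem (Nat.le_succ _) le_rfl ((mem (i + 1, j)).2 ⟨h, by simp⟩))
  rw [YoungDiagram.mem_iff_lt_rowLen] at h2 h3
  simp only; omega

theorem addable_left {lam : YoungDiagram} {b : ℕ × ℕ} (h : IsAddable lam b) (k : ℕ) :
    LeftOf b (k, lam.rowLen k) ↔ b.1 < k := by
  have h1 := addable_rowLen h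
  simp only [LeftOf, content]
  constructor
  · intro h2
    by_contra h3
    have := lam.rowLen_anti k b.1 (by omega)
    omega
  · intro h2
    have := lam.rowLen_anti b.1 k (by omega)
    omega

theorem removable_left {lam : YoungDiagram} {b : ℕ × ℕ} (h : IsRemovable lam b) (k : ℕ) :
    LeftOf b (k, lam.rowLen k) ↔ b.1 < k := by
  have h1 := removable_rowLen h
  simp only [LeftOf, content]
  constructor
  · intro h2
    by_contra h3
    have := lam.rowLen_anti k b.1 (by omega)
    omega
  · intro h2
    have := lam.rowLen_anti (b.1 + 1) k (by omega)
    omega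

theorem finite_Alt (lam : YoungDiagram) (k : ℕ) : (Alt lam k).Finite := by
  refine ((Set.finite_Iio k).image fun j => (j, lam.rowLen j)).subset ?_
  rintro b ⟨hb, hk⟩
  exact ⟨b.1, hk, by ext <;> simp [addable_rowLen hb]⟩

theorem finite_Rlt (lam : YoungDiagram) (k : ℕ) : (Rlt lam k).Finite := by
  refine ((Set.finite_Iio k).image fun j => (j, lam.rowLen j - 1)).subset ?_
  rintro b ⟨hb, hk⟩
  exact ⟨b.1, hk, by ext <;> simp [(removable_rowLen hb).1]⟩

theorem hasVal_finprod (ℓ : ℕ) (hℓ : 2 ≤ ℓ) (S : Set (ℕ × ℕ)) (hS : S.Finite) (b : ℕ × ℕ)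
    (hl : ∀ x ∈ S, LeftOf x b) :
    hasVal (Polynomial.cyclotomic (2 * ℓ) ℚ) (∏ᶠ r ∈ S, qint (content r - content b))
      ({x | x ∈ S ∧ color ℓ x = color ℓ b}.ncard : ℤ) := by
  rw [finprod_mem_eq_finite_toFinset_prod _ hS]
  have hcard : ({x | x ∈ S ∧ color ℓ x = color ℓ b}.ncard : ℤ) =
      ∑ x ∈ hS.toFinset, if color ℓ x = color ℓ b then (1 : ℤ) else 0 := by
    rw [Finset.sum_boole, ← Set.ncard_coe_finset]
    congr 2
    ext x; simp
  rw [hcard]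
  refine hasVal_prod (cyc_prime ℓ hℓ) _ _ _ fun x hx => ?_
  have hlt := hl x (hS.mem_toFinset.1 hx)
  unfold LeftOf at hlt
  obtain ⟨n, hn⟩ := Int.eq_ofNat_of_zero_le (sub_nonneg.2 hlt.le)
  have hiff : color ℓ x = color ℓ b ↔ ℓ ∣ n := by
    rw [color, color, eq_comm, ZMod.intCast_eq_intCast_iff_dvd_sub, hn]
    exact Int.natCast_dvd_natCast
  rw [hn]
  simp only [hiff]
  exact hasVal_qint ℓ hℓ n (by omega)

theorem stmt10 (ℓ : ℕ) (hℓ : 2 ≤ ℓ) (lam : YoungDiagram) (k : ℕ)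
    (hb : IsAddable lam (k, lam.rowLen k)) (c : ℤ) (hc : c = (lam.rowLen k : ℤ) - k)
    (i : ZMod ℓ) (hi : i = color ℓ (k, lam.rowLen k)) :
    ((∏ᶠ r ∈ Rlt lam k, qint (content r - c)) / (∏ᶠ a ∈ Alt lam k, qint (content a - c))) ≠ 0 ∧
    hasVal (Polynomial.cyclotomic (2 * ℓ) ℚ)
      ((∏ᶠ r ∈ Rlt lam k, qint (content r - c)) / (∏ᶠ a ∈ Alt lam k, qint (content a - c)))
      (Nl ℓ i lam (k, lam.rowLen k)) := by
  have hcc : c = content (k, lam.rowLen k) := by rw [hc]; rfl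
  have hR := hasVal_finprod ℓ hℓ (Rlt lam k) (finite_Rlt lam k) (k, lam.rowLen k)
    fun x hx => (removable_left hx.1 k).2 hx.2
  have hA := hasVal_finprod ℓ hℓ (Alt lam k) (finite_Alt lam k) (k, lam.rowLen k)
    fun x hx => (addable_left hx.1 k).2 hx.2
  rw [← hcc, ← hi] at hR hA
  have e1 : {x | x ∈ Rlt lam k ∧ color ℓ x = i} =
      {b' | b' ∈ R ℓ i lam ∧ LeftOf b' (k, lam.rowLen k)} := by
    ext x
    constructor
    · rintro ⟨⟨h1, h2⟩, h3⟩
      exact ⟨⟨h1, h3⟩, (removable_left h1 k).2 h2⟩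
    · rintro ⟨⟨h1, h3⟩, h2⟩
      exact ⟨⟨h1, (removable_left h1 k).1 h2⟩, h3⟩
  have e2 : {x | x ∈ Alt lam k ∧ color ℓ x = i} =
      {b' | b' ∈ A ℓ i lam ∧ LeftOf b' (k, lam.rowLen k)} := by
    ext x
    constructor
    · rintro ⟨⟨h1, h2⟩, h3⟩
      exact ⟨⟨h1, h3⟩, (addable_left h1 k).2 h2⟩
    · rintro ⟨⟨h1, h3⟩, h2⟩
      exact ⟨⟨h1, (addable_left h1 k).1 h2⟩, h3⟩
  rw [e1] at hR
  rw [e2] at hA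
  have := hasVal_mul (cyc_prime ℓ hℓ) hR (hasVal_inv hA)
  rw [← div_eq_mul_inv, ← sub_eq_add_neg] at this
  exact ⟨hasVal_ne_zero (cyc_prime ℓ hℓ) this, this⟩

end MisraMiwa
end
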